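/- Let R be a commutative ring, p ≥ 1, n = 2^p, and ω ∈ R with ω^{n/2} = −1. Let a ∈ R^n and let x_0, …, x_p ∈ R^n be the family defined by the butterfly recurrence. Then for every i with 0 ≤ i < n, x_{p, i} = DFT_ω(a)_{[i]_p} and DFT_ω(a)_i = x_{p, [i]_p}, where [i]_p is the length-p bitwise reverse of i. -/

import Mathlib

/-- The discrete Fourier transform of a length-`n` vector (given as a function `ℕ → R`
restricted to indices `< n`) with respect to `ω`:  `(dft n ω a) i = ∑_{j<n} a j * ω^(i*j)`. -/
def dft {R : Type*} [CommRing R] (n : ℕ) (ω : R) (a : ℕ → R) (i : ℕ) : R :=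
  ∑ j ∈ Finset.range n, a j * ω ^ (i * j)

/-- `bitrev p i` is the length-`p` bitwise reverse `[i]_p` of `i`. -/
def bitrev : ℕ → ℕ → ℕ
  | 0, _ => 0
  | p + 1, i => (i % 2) * 2 ^ p + bitrev p (i / 2)

theorem bitrev_lt_two_pow (p i : ℕ) : bitrev p i < 2 ^ p := by
  induction p generalizing i with
  | zero => simp [bitrev]
  | succ p ih =>
    have h := ih (i / 2)
    rw [bitrev, pow_succ]
    rcases Nat.mod_two_eq_zero_or_one i with h2 | h2 <;> rw [h2] <;> omega

theorem bitrev_succ_mul_two_pow_add (p b r : ℕ) (hb : b < 2) (hr : r < 2 ^ p) :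
    bitrev (p + 1) (b * 2 ^ p + r) = 2 * bitrev p r + b := by
  induction p generalizing r with
  | zero =>
    obtain rfl : r = 0 := by simpa using hr
    simp [bitrev, Nat.mod_eq_of_lt hb]
  | succ p ih =>
    rw [pow_succ] at hr
    have hmul : b * 2 ^ (p + 1) = 2 * (b * 2 ^ p) := by ring
    have hmod : (b * 2 ^ (p + 1) + r) % 2 = r % 2 := by omega
    have hdiv : (b * 2 ^ (p + 1) + r) / 2 = b * 2 ^ p + r / 2 := by omega
    rw [bitrev, hmod, hdiv, ih (r / 2) (by omega), bitrev]
    ring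

theorem bitrev_bitrev (p i : ℕ) (hi : i < 2 ^ p) : bitrev p (bitrev p i) = i := by
  induction p generalizing i with
  | zero => simpa [bitrev, eq_comm] using hi
  | succ p ih =>
    rw [pow_succ] at hi
    rw [bitrev.eq_2 i p, bitrev_succ_mul_two_pow_add p _ _ (Nat.mod_lt _ two_pos)
      (bitrev_lt_two_pow p _), ih _ (by omega)]
    omega

theorem bitrev_succ_two_mul (p q : ℕ) : bitrev (p + 1) (2 * q) = bitrev p q := by
  simp [bitrev]

theorem bitrev_succ_two_mul_add_one (p q : ℕ) :
    bitrev (p + 1) (2 * q + 1) = 2 ^ p + bitrev p q := by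
  have hmod : (2 * q + 1) % 2 = 1 := by omega
  have hdiv : (2 * q + 1) / 2 = q := by omega
  rw [bitrev, hmod, hdiv, one_mul]

theorem sum_range_two_mul_eq_even_add_odd {M : Type*} [AddCommMonoid M] (f : ℕ → M) (n : ℕ) :
    ∑ k ∈ Finset.range (2 * n), f k
      = ∑ l ∈ Finset.range n, f (2 * l) + ∑ l ∈ Finset.range n, f (2 * l + 1) := by
  induction n with
  | zero => simp
  | succ n ih =>
    rw [mul_add, mul_one, Finset.sum_range_succ, Finset.sum_range_succ, ih,
      Finset.sum_range_succ, Finset.sum_range_succ]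
    abel

/-- Row `s` of the butterfly recurrence consists of the `ω ^ (2 ^ (p - s))`-transforms of the
subsequences of `a` with stride `2 ^ (p - s)`, in bit-reversed order. -/
theorem butterfly_row_eq_sum {R : Type*} [CommRing R]
    (p : ℕ) (ω : R) (hω : ω ^ (2 ^ (p - 1)) = -1)
    (a : ℕ → R) (x : ℕ → ℕ → R)
    (hx0 : ∀ i < 2 ^ p, x 0 i = a i)
    (hxs : ∀ s, 1 ≤ s → s ≤ p → ∀ i j, Even i → i < 2 ^ s → j < 2 ^ (p - s) →
      x s (i * 2 ^ (p - s) + j) =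
          x (s - 1) (i * 2 ^ (p - s) + j)
            + ω ^ (bitrev s i * 2 ^ (p - s)) * x (s - 1) ((i + 1) * 2 ^ (p - s) + j) ∧
      x s ((i + 1) * 2 ^ (p - s) + j) =
          x (s - 1) (i * 2 ^ (p - s) + j)
            - ω ^ (bitrev s i * 2 ^ (p - s)) * x (s - 1) ((i + 1) * 2 ^ (p - s) + j))
    (s : ℕ) (hs : s ≤ p) (i j : ℕ) (hi : i < 2 ^ s) (hj : j < 2 ^ (p - s)) :
    x s (i * 2 ^ (p - s) + j) =
      ∑ k ∈ Finset.range (2 ^ s), a (k * 2 ^ (p - s) + j) * ω ^ (bitrev s i * k * 2 ^ (p - s)) := by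
  induction s generalizing i j with
  | zero =>
    obtain rfl : i = 0 := by simpa using hi
    simpa [bitrev] using hx0 j (by simpa using hj)
  | succ s ih =>
    have hstride : 2 ^ (p - s) = 2 * 2 ^ (p - (s + 1)) := by
      rw [← pow_succ']
      congr 1
      omega
    have hhalf : ω ^ (2 ^ s * 2 ^ (p - (s + 1))) = -1 := by
      rw [← pow_add, show s + (p - (s + 1)) = p - 1 by omega, hω]
    have hrow := hxs (s + 1) (by omega) hs
    have ih' := ih (by omega)
    rw [Nat.add_sub_cancel] at hrow
    rw [hstride] at ih'
    generalize 2 ^ (p - (s + 1)) = m at *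
    obtain ⟨q, hq⟩ : ∃ q, q = i / 2 := ⟨_, rfl⟩
    have hq_lt : q < 2 ^ s := by
      rw [pow_succ] at hi
      omega
    have hlow : x s (2 * q * m + j) =
        ∑ l ∈ Finset.range (2 ^ s), a (2 * l * m + j) * ω ^ (bitrev s q * (2 * l) * m) := by
      rw [show 2 * q * m + j = q * (2 * m) + j by ring, ih' q j hq_lt (by omega)]
      refine Finset.sum_congr rfl fun l _ => ?_
      congr 2 <;> ring
    have hhigh : ω ^ (bitrev s q * m) * x s ((2 * q + 1) * m + j) =
        ∑ l ∈ Finset.range (2 ^ s),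
          a ((2 * l + 1) * m + j) * ω ^ (bitrev s q * (2 * l + 1) * m) := by
      rw [show (2 * q + 1) * m + j = q * (2 * m) + (m + j) by ring,
        ih' q (m + j) hq_lt (by omega), Finset.mul_sum]
      refine Finset.sum_congr rfl fun l _ => ?_
      rw [show (2 * l + 1) * m + j = l * (2 * m) + (m + j) by ring]
      ring
    have hrow_q := hrow (2 * q) j (even_two_mul q) (by rw [pow_succ]; omega) hj
    rw [bitrev_succ_two_mul, hlow, hhigh] at hrow_q
    rw [pow_succ', sum_range_two_mul_eq_even_add_odd]
    rcases Nat.mod_two_eq_zero_or_one i with h2 | h2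
    · obtain rfl : i = 2 * q := by omega
      rw [hrow_q.1, bitrev_succ_two_mul]
    · obtain rfl : i = 2 * q + 1 := by omega
      have htwiddle (k : ℕ) : ω ^ ((2 ^ s + bitrev s q) * k * m)
          = (-1) ^ k * ω ^ (bitrev s q * k * m) := by
        rw [← hhalf]
        ring
      simp only [hrow_q.2, bitrev_succ_two_mul_add_one, htwiddle]
      simp [pow_succ, pow_mul, sub_eq_add_neg]

/-- The last row of the butterfly recurrence is the bit-reversed DFT:
`x_{p,i} = DFT_ω(a)_{[i]_p}` and `DFT_ω(a)_i = x_{p,[i]_p}` for all `i < n = 2^p`. -/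
theorem butterfly_final_row_is_bitreversed_dft {R : Type*} [CommRing R]
    (p : ℕ) (hp : 1 ≤ p) (ω : R) (hω : ω ^ (2 ^ (p - 1)) = -1)
    (a : ℕ → R) (x : ℕ → ℕ → R)
    (hx0 : ∀ i < 2 ^ p, x 0 i = a i)
    (hxs : ∀ s, 1 ≤ s → s ≤ p → ∀ i j, Even i → i < 2 ^ s → j < 2 ^ (p - s) →
      x s (i * 2 ^ (p - s) + j) =
          x (s - 1) (i * 2 ^ (p - s) + j)
            + ω ^ (bitrev s i * 2 ^ (p - s)) * x (s - 1) ((i + 1) * 2 ^ (p - s) + j) ∧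
      x s ((i + 1) * 2 ^ (p - s) + j) =
          x (s - 1) (i * 2 ^ (p - s) + j)
            - ω ^ (bitrev s i * 2 ^ (p - s)) * x (s - 1) ((i + 1) * 2 ^ (p - s) + j)) :
    ∀ i < 2 ^ p, x p i = dft (2 ^ p) ω a (bitrev p i) ∧ dft (2 ^ p) ω a i = x p (bitrev p i) := by
  have hrow (i : ℕ) (hi : i < 2 ^ p) : x p i = dft (2 ^ p) ω a (bitrev p i) := by
    simpa [dft] using
      butterfly_row_eq_sum p ω hω a x hx0 hxs p le_rfl i 0 hi (Nat.two_pow_pos _)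
  refine fun i hi => ⟨hrow i hi, ?_⟩
  rw [hrow _ (bitrev_lt_two_pow p i), bitrev_bitrev p i hi]
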